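/- arXiv:2409.14462 — 3 statements merged into one kernel-verified Lean document; each statement's English description precedes it below -/
import Mathlib

section
/- Let {C_1, …, C_{K1}} be a (K1, L1)-CCC and {D_1, …, D_{K2}} be a (K2, L2)-CCC. Then the family {C_u ⊗ D_v : 1 ≤ u ≤ K1, 1 ≤ v ≤ K2}, where C_u ⊗ D_v is the code whose (i,j)-th sequence (1 ≤ i ≤ K1, 1 ≤ j ≤ K2) is the Kronecker product of the i-th sequence of C_u with the j-th sequence of D_v, forms a (K1·K2, L1·L2)-CCC. -/
open scoped Classical

/-- Aperiodic cross-correlation function (ACCF) of two length-`L` complex sequences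
at integer shift `τ`:
`Θ(a,b)(τ) = ∑_{t=0}^{L−τ−1} a_t · conj(b_{t+τ})` for `0 ≤ τ`, and
`Θ(a,b)(τ) = ∑_{t=0}^{L+τ−1} a_{t−τ} · conj(b_t)` for `τ < 0`. -/
noncomputable def accf (L : ℕ) (a b : ℕ → ℂ) (τ : ℤ) : ℂ :=
  if 0 ≤ τ then
    ∑ t ∈ Finset.range (L - τ.toNat), a t * (starRingEnd ℂ) (b (t + τ.toNat))
  else
    ∑ t ∈ Finset.range (L - (-τ).toNat), a (t + (-τ).toNat) * (starRingEnd ℂ) (b t)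

/-- ACCF (sum) of two codes, i.e. tuples of length-`L` sequences indexed by `κ`:
`Θ(C, C')(τ) = ∑_m Θ(c^m, c'^m)(τ)`. -/
noncomputable def codeACCF {κ : Type*} [Fintype κ] (L : ℕ) (C C' : κ → ℕ → ℂ)
    (τ : ℤ) : ℂ :=
  ∑ m : κ, accf L (C m) (C' m) τ

/-- A family of codes `C_k` (`k : ι`), each a (`card κ`)-tuple of length-`L` sequences,
is a set of complete complementary codes (CCC) if the number of sequences per code equals
the number `K` of codes, `Θ(C_{k₁}, C_{k₂})(0) = K·L`, and all other aperiodic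
auto/cross-correlation sums with `|τ| < L` vanish. -/
noncomputable def IsCCC {ι κ : Type*} [Fintype ι] [Fintype κ] (L : ℕ)
    (C : ι → κ → ℕ → ℂ) : Prop :=
  Fintype.card κ = Fintype.card ι ∧
  ∀ k₁ k₂ : ι, ∀ τ : ℤ, |τ| < (L : ℤ) →
    codeACCF L (C k₁) (C k₂) τ =
      if τ = 0 ∧ k₁ = k₂ then ((Fintype.card ι : ℂ) * (L : ℂ)) else 0

/-- Kronecker product of a length-`L₁` sequence `a` with a length-`L₂` sequence `b`:
the length-`L₁·L₂` sequence whose entry at index `i·L₂ + j` (`0 ≤ j < L₂`) is `a_i·b_j`. -/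
noncomputable def kron (L₂ : ℕ) (a b : ℕ → ℂ) : ℕ → ℂ :=
  fun n => a (n / L₂) * b (n % L₂)

/-- The ACCF as a sum over all pairs of positions that differ by the shift. -/
theorem accf_eq_sum_sum (L : ℕ) (a b : ℕ → ℂ) (τ : ℤ) :
    accf L a b τ = ∑ t ∈ Finset.range L, ∑ s ∈ Finset.range L,
      if (s : ℤ) = t + τ then a t * (starRingEnd ℂ) (b s) else 0 := by
  unfold accf
  split_ifs with hτ
  · obtain ⟨n, rfl⟩ := Int.eq_ofNat_of_zero_le hτ
    have hcond : ∀ s t : ℕ, ((s : ℤ) = t + (n : ℤ)) ↔ s = t + n := by omega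
    simp only [Int.toNat_natCast, hcond, Finset.sum_ite_eq', Finset.mem_range]
    rw [← Finset.sum_filter]
    refine Finset.sum_congr ?_ fun _ _ => rfl
    ext t
    simp only [Finset.mem_range, Finset.mem_filter]
    omega
  · obtain ⟨n, hn⟩ := Int.eq_ofNat_of_zero_le (show 0 ≤ -τ by omega)
    obtain rfl : τ = -(n : ℤ) := by omega
    have hcond : ∀ s t : ℕ, ((s : ℤ) = t + -(n : ℤ)) ↔ t = s + n := by omega
    rw [Finset.sum_comm]
    simp only [neg_neg, Int.toNat_natCast, hcond, Finset.sum_ite_eq', Finset.mem_range]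
    rw [← Finset.sum_filter]
    refine Finset.sum_congr ?_ fun _ _ => rfl
    ext t
    simp only [Finset.mem_range, Finset.mem_filter]
    omega

theorem accf_eq_zero_of_le_abs {L : ℕ} (a b : ℕ → ℂ) {τ : ℤ} (h : (L : ℤ) ≤ |τ|) :
    accf L a b τ = 0 := by
  rw [accf_eq_sum_sum]
  refine Finset.sum_eq_zero fun t ht => Finset.sum_eq_zero fun s hs => if_neg ?_
  rw [Finset.mem_range] at ht hs
  rcases le_abs.1 h with h | h <;> omega

theorem sum_range_mul_eq_sum_sum (m n : ℕ) (f : ℕ → ℂ) :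
    ∑ k ∈ Finset.range (m * n), f k =
      ∑ i ∈ Finset.range m, ∑ j ∈ Finset.range n, f (i * n + j) := by
  induction m with
  | zero => simp
  | succ m ih => rw [Nat.succ_mul, Finset.sum_range_add, ih, Finset.sum_range_succ]

theorem kron_mul_add {L : ℕ} (a b : ℕ → ℂ) (i : ℕ) {j : ℕ} (hj : j < L) :
    kron L a b (i * L + j) = a i * b j := by
  have hL : 0 < L := by omega
  rw [kron, Nat.add_comm, Nat.add_mul_div_right _ _ hL, Nat.add_mul_mod_self_right,
    Nat.div_eq_of_lt hj, Nat.mod_eq_of_lt hj, Nat.zero_add]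

/-- Two digit expansions in base `L` differ by `τ` exactly when the digits differ by the
quotient and remainder of `τ`, possibly with a carry. -/
theorem digits_eq_add_iff {L i j i' j' : ℕ} (hj : j < L) (hj' : j' < L) (τ : ℤ) :
    ((i' * L + j' : ℕ) : ℤ) = (i * L + j : ℕ) + τ ↔
      ((i' : ℤ) = i + τ / L ∧ (j' : ℤ) = j + τ % L) ∨
      ((i' : ℤ) = i + (τ / L + 1) ∧ (j' : ℤ) = j + (τ % L - L)) := by
  have hL : (0 : ℤ) < L := by omega
  have hr := Int.emod_nonneg τ hL.ne'
  have hr' := Int.emod_lt_of_pos τ hL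
  have hqr := Int.mul_ediv_add_emod τ L
  generalize τ / (L : ℤ) = q at *
  generalize τ % (L : ℤ) = r at *
  subst hqr
  push_cast
  constructor
  · intro h
    have key : ((i' : ℤ) - i - q) * L = j + r - j' := by linarith
    have h1 : (i' : ℤ) - i - q < 2 := by nlinarith
    have h2 : -1 < (i' : ℤ) - i - q := by nlinarith
    have h3 : (i' : ℤ) - i - q = 0 ∨ (i' : ℤ) - i - q = 1 := by omega
    rcases h3 with h3 | h3
    · rw [h3] at key
      left
      constructor <;> linarith
    · rw [h3] at key
      right
      constructor <;> linarith
  · rintro (⟨h1, h2⟩ | ⟨h1, h2⟩) <;> rw [h1, h2] <;> ring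

/-- The ACCF of Kronecker products in terms of the ACCFs of the factors. -/
theorem accf_kron (L₁ L₂ : ℕ) (a a' b b' : ℕ → ℂ) (τ : ℤ) :
    accf (L₁ * L₂) (kron L₂ a b) (kron L₂ a' b') τ =
      accf L₁ a a' (τ / L₂) * accf L₂ b b' (τ % L₂) +
      accf L₁ a a' (τ / L₂ + 1) * accf L₂ b b' (τ % L₂ - L₂) := by
  simp only [accf_eq_sum_sum, sum_range_mul_eq_sum_sum, Finset.sum_mul_sum,
    ← Finset.sum_add_distrib]
  refine Finset.sum_congr rfl fun i _ => Finset.sum_congr rfl fun j hj =>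
    Finset.sum_congr rfl fun i' _ => Finset.sum_congr rfl fun j' hj' => ?_
  rw [Finset.mem_range] at hj hj'
  rw [kron_mul_add a b i hj, kron_mul_add a' b' i' hj']
  simp only [digits_eq_add_iff hj hj', map_mul]
  split_ifs <;> first | omega | ring

theorem codeACCF_kron {κ₁ κ₂ : Type*} [Fintype κ₁] [Fintype κ₂] (L₁ L₂ : ℕ)
    (A A' : κ₁ → ℕ → ℂ) (B B' : κ₂ → ℕ → ℂ) (τ : ℤ) :
    codeACCF (L₁ * L₂) (fun p : κ₁ × κ₂ => kron L₂ (A p.1) (B p.2))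
        (fun p => kron L₂ (A' p.1) (B' p.2)) τ =
      codeACCF L₁ A A' (τ / L₂) * codeACCF L₂ B B' (τ % L₂) +
      codeACCF L₁ A A' (τ / L₂ + 1) * codeACCF L₂ B B' (τ % L₂ - L₂) := by
  simp only [codeACCF, accf_kron, Fintype.sum_prod_type, Finset.sum_mul_sum,
    Finset.sum_add_distrib]

/-- The defining identity of a CCC holds without restriction on the shift. -/
theorem IsCCC.codeACCF_eq {ι κ : Type*} [Fintype ι] [Fintype κ] {L : ℕ}
    {C : ι → κ → ℕ → ℂ} (hC : IsCCC L C) (k₁ k₂ : ι) (τ : ℤ) :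
    codeACCF L (C k₁) (C k₂) τ =
      if τ = 0 ∧ k₁ = k₂ then ((Fintype.card ι : ℂ) * (L : ℂ)) else 0 := by
  by_cases hτ : |τ| < (L : ℤ)
  · exact hC.2 k₁ k₂ τ hτ
  · have hle := not_lt.1 hτ
    rw [codeACCF, Finset.sum_eq_zero fun m _ => accf_eq_zero_of_le_abs _ _ hle]
    split_ifs with h
    · have hL : L = 0 := by simpa [h.1] using hle
      simp [hL]
    · rfl

/-- the Kronecker product of a `(K₁, L₁)`-CCC and a `(K₂, L₂)`-CCC
is a `(K₁·K₂, L₁·L₂)`-CCC. -/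
theorem stmt_5 (K₁ K₂ L₁ L₂ : ℕ)
    (C : Fin K₁ → Fin K₁ → ℕ → ℂ) (D : Fin K₂ → Fin K₂ → ℕ → ℂ)
    (hC : IsCCC L₁ C) (hD : IsCCC L₂ D) :
    IsCCC (L₁ * L₂)
      (fun (uv : Fin K₁ × Fin K₂) (ij : Fin K₁ × Fin K₂) =>
        kron L₂ (C uv.1 ij.1) (D uv.2 ij.2)) := by
  refine ⟨by simp, ?_⟩
  rintro ⟨u, v⟩ ⟨u', v'⟩ τ hτ
  have hL : (L₂ : ℤ) ≠ 0 := by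
    rintro h
    have := abs_nonneg τ
    simp only [Nat.cast_mul, h, mul_zero] at hτ
    omega
  have hr : τ % (L₂ : ℤ) - L₂ ≠ 0 := by
    have := Int.emod_lt_of_pos τ (show (0 : ℤ) < L₂ by omega)
    omega
  have hzero : τ = 0 ↔ τ / (L₂ : ℤ) = 0 ∧ τ % (L₂ : ℤ) = 0 := by
    constructor
    · rintro rfl
      simp
    · rintro ⟨h1, h2⟩
      have := Int.mul_ediv_add_emod τ L₂
      simpa [h1, h2] using this.symm
  rw [codeACCF_kron, hC.codeACCF_eq, hD.codeACCF_eq, hC.codeACCF_eq, hD.codeACCF_eq]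
  simp only [hr, false_and, if_false, mul_zero, add_zero, hzero, Prod.mk.injEq,
    Fintype.card_prod, Nat.cast_mul]
  split_ifs <;> first | (exfalso; tauto) | ring
end

section
/- Let q ≥ 2 and m ≥ 2 be integers and τ = q^m − n·q^{m−i} where 1 ≤ i ≤ m−1 and 1 ≤ n ≤ q−1. For x, y ∈ {0, …, q^m − 1}, one has y = x + τ if and only if, writing the base-q digit expansions x = ∑_{j=1}^m x_j q^{j−1} and y = ∑_{j=1}^m y_j q^{j−1}: y_j = x_j for 1 ≤ j ≤ m−i; 0 ≤ x_{m−i+1} ≤ n−1 and y_{m−i+1} = x_{m−i+1} + q − n; and x_j = 0 and y_j = q−1 for all m−i+2 ≤ j ≤ m. Consequently the number of pairs (x, y) ∈ {0, …, q^m−1}² with y = x + τ is exactly n·q^{m−i}. -/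
/-- The lowest `k` base-`q` digits determine, and are determined by, the residue mod `q ^ k`. -/
theorem forall_div_pow_mod_eq_iff (q k x y : ℕ) :
    (∀ j < k, y / q ^ j % q = x / q ^ j % q) ↔ y % q ^ k = x % q ^ k := by
  induction k with
  | zero => simp [Nat.mod_one]
  | succ k ih =>
    constructor
    · intro h
      rw [Nat.mod_pow_succ, Nat.mod_pow_succ, h k (Nat.lt_succ_self k),
        ih.1 fun j hj => h j (hj.trans (Nat.lt_succ_self k))]
    · intro h j hj
      have key : ∀ z : ℕ, z % q ^ (k + 1) / q ^ j % q = z / q ^ j % q := by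
        intro z
        obtain ⟨d, rfl⟩ : ∃ d, k = j + d := ⟨k - j, by omega⟩
        rw [show j + d + 1 = j + (d + 1) by ring, pow_add, Nat.mod_mul_right_div_self,
          Nat.mod_mod_of_dvd _ (dvd_pow_self q (Nat.succ_ne_zero d))]
      rw [← key, h, key]

/-- All of the lowest `s` base-`q` digits of `q ^ s - 1` equal `q - 1`. -/
theorem pow_sub_one_div_pow_mod {q s j : ℕ} (hq : 0 < q) (hj : j < s) :
    (q ^ s - 1) / q ^ j % q = q - 1 := by
  obtain ⟨d, rfl⟩ : ∃ d, s = j + (d + 1) := ⟨s - j - 1, by omega⟩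
  have hd : 0 < q ^ d := pow_pos hq d
  have hj : 0 < q ^ j := pow_pos hq j
  have h : q ^ (j + (d + 1)) - 1 = q ^ j - 1 + q ^ j * (q - 1 + q * (q ^ d - 1)) := by
    rw [pow_add, pow_succ]
    zify [Nat.one_le_iff_ne_zero.2 hd.ne', Nat.one_le_iff_ne_zero.2 hj.ne', hq,
      Nat.one_le_iff_ne_zero.2 (Nat.mul_pos hj (Nat.mul_pos hd hq)).ne']
    ring
  rw [h, Nat.add_mul_div_left _ _ hj, Nat.div_eq_of_lt (by omega), zero_add,
    Nat.add_mul_mod_self_left, Nat.mod_eq_of_lt (by omega)]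

/-- Digit description of `c = b + (q ^ (s + 1) - n)` for `b, c < q ^ (s + 1)` and `1 ≤ n < q`. -/
theorem eq_add_pow_sub_iff_digits {q s n b c : ℕ} (hn : 1 ≤ n) (hnq : n < q)
    (hb : b < q ^ (s + 1)) (hc : c < q ^ (s + 1)) :
    c = b + (q ^ (s + 1) - n) ↔ b % q ≤ n - 1 ∧ c % q = b % q + q - n ∧
      ∀ j < s, b / q / q ^ j % q = 0 ∧ c / q / q ^ j % q = q - 1 := by
  have hq : 0 < q := by omega
  have hP : 0 < q ^ s := pow_pos hq s
  have hb' : b / q < q ^ s := Nat.div_lt_of_lt_mul (by rwa [← pow_succ'])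
  have hc' : c / q < q ^ s := Nat.div_lt_of_lt_mul (by rwa [← pow_succ'])
  have hhigh : (∀ j < s, b / q / q ^ j % q = 0 ∧ c / q / q ^ j % q = q - 1) ↔
      b / q = 0 ∧ c / q = q ^ s - 1 := by
    constructor
    · intro h
      have h1 := (forall_div_pow_mod_eq_iff q s 0 (b / q)).1 fun j hj => by simp [(h j hj).1]
      have h2 := (forall_div_pow_mod_eq_iff q s (q ^ s - 1) (c / q)).1 fun j hj => by
        rw [(h j hj).2, pow_sub_one_div_pow_mod hq hj]
      rw [Nat.mod_eq_of_lt hb', Nat.zero_mod] at h1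
      rw [Nat.mod_eq_of_lt hc', Nat.mod_eq_of_lt (by omega)] at h2
      exact ⟨h1, h2⟩
    · rintro ⟨h1, h2⟩ j hj
      rw [h1, h2, pow_sub_one_div_pow_mod hq hj]
      simp
  rw [hhigh]
  have hbd := Nat.div_add_mod b q
  have hcd := Nat.div_add_mod c q
  obtain ⟨P, hPe⟩ : ∃ P, q ^ s = P + 1 := ⟨q ^ s - 1, by omega⟩
  have hpow : q ^ (s + 1) = q * P + q := by rw [pow_succ', hPe]; ring
  rw [hpow] at hc ⊢
  rw [hPe, Nat.add_sub_cancel]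
  constructor
  · intro h
    have hbn : b < n := by omega
    have hce : c = (b + q - n) + q * P := by omega
    rw [Nat.mod_eq_of_lt (hbn.trans hnq), Nat.div_eq_of_lt (hbn.trans hnq), hce,
      Nat.add_mul_mod_self_left, Nat.add_mul_div_left _ _ hq, Nat.mod_eq_of_lt (by omega),
      Nat.div_eq_of_lt (by omega)]
    omega
  · rintro ⟨h1, h2, h3, h4⟩
    rw [h3, mul_zero] at hbd
    rw [h4] at hcd
    omega

/-- Adding a multiple of `r` fixes the remainder mod `r` and shifts the quotient. -/
theorem eq_add_mul_iff_mod_div {r x y t : ℕ} (hr : 0 < r) :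
    y = x + r * t ↔ y % r = x % r ∧ y / r = x / r + t := by
  constructor
  · rintro rfl
    exact ⟨Nat.add_mul_mod_self_left _ _ _, Nat.add_mul_div_left _ _ hr⟩
  · rintro ⟨h1, h2⟩
    rw [← Nat.div_add_mod y r, h1, h2, mul_add, add_right_comm, Nat.div_add_mod]

/-- If `T ≤ N`, exactly `T` pairs `(x, y)` in `{0, …, N - 1}²` satisfy `y = x + (N - T)`. -/
theorem card_filter_eq_add_sub {N T : ℕ} (h : T ≤ N) :
    ((Finset.range N ×ˢ Finset.range N).filter
      (fun p : ℕ × ℕ => p.2 = p.1 + (N - T))).card = T := by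
  have himage : (Finset.range N ×ˢ Finset.range N).filter
      (fun p : ℕ × ℕ => p.2 = p.1 + (N - T)) =
      (Finset.range T).image fun x => (x, x + (N - T)) := by
    ext ⟨x, y⟩
    simp only [Finset.mem_filter, Finset.mem_product, Finset.mem_range, Finset.mem_image,
      Prod.mk.injEq]
    constructor
    · rintro ⟨⟨hx, hy⟩, hxy⟩
      exact ⟨x, by omega, rfl, hxy.symm⟩
    · rintro ⟨z, hz, rfl, rfl⟩
      omega
  rw [himage, Finset.card_image_of_injective _ fun a b hab => congrArg Prod.fst hab,
    Finset.card_range]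


/-- let `q ≥ 2`, `m ≥ 2`, `1 ≤ i ≤ m−1`, `1 ≤ n ≤ q−1` and
`τ = q^m − n·q^{m−i}`.  For `x, y ∈ {0,…,q^m−1}` with base-`q` digits
`x_j = x / q^{j−1} mod q` (`1 ≤ j ≤ m`, written below 0-indexed as `x / q^j % q`),
one has `y = x + τ` iff the digits of `x` and `y` agree at positions `1,…,m−i`,
`x_{m−i+1} ≤ n−1` with `y_{m−i+1} = x_{m−i+1} + q − n`, and `x_j = 0`, `y_j = q−1`
for `m−i+2 ≤ j ≤ m`.  Consequently, exactly `n·q^{m−i}` pairs `(x,y)` in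
`{0,…,q^m−1}²` satisfy `y = x + τ`. -/
theorem stmt_6 (q m i n : ℕ) (hq : 2 ≤ q) (hm : 2 ≤ m) (hi : 1 ≤ i) (him : i ≤ m - 1)
    (hn : 1 ≤ n) (hnq : n ≤ q - 1) :
    (∀ x y : ℕ, x < q ^ m → y < q ^ m →
      (y = x + (q ^ m - n * q ^ (m - i)) ↔
        ((∀ j < m - i, y / q ^ j % q = x / q ^ j % q) ∧
          x / q ^ (m - i) % q ≤ n - 1 ∧
          y / q ^ (m - i) % q = x / q ^ (m - i) % q + q - n ∧
          (∀ j, m - i + 1 ≤ j → j < m → x / q ^ j % q = 0 ∧ y / q ^ j % q = q - 1)))) ∧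
    ((Finset.range (q ^ m) ×ˢ Finset.range (q ^ m)).filter
        (fun p : ℕ × ℕ => p.2 = p.1 + (q ^ m - n * q ^ (m - i)))).card =
      n * q ^ (m - i) := by
  obtain ⟨s, rfl⟩ : ∃ s, i = s + 1 := ⟨i - 1, by omega⟩
  obtain ⟨k, rfl⟩ : ∃ k, m = k + (s + 1) := ⟨m - (s + 1), by omega⟩
  rw [Nat.add_sub_cancel]
  have hq0 : 0 < q := by omega
  have hr : 0 < q ^ k := pow_pos hq0 k
  have hnlt : n < q := by omega
  have hnpow : n ≤ q ^ (s + 1) := hnlt.le.trans (Nat.le_self_pow (Nat.succ_ne_zero s) q)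
  have hτ : q ^ (k + (s + 1)) - n * q ^ k = q ^ k * (q ^ (s + 1) - n) := by
    rw [pow_add, Nat.mul_sub, mul_comm n]
  refine ⟨fun x y hx hy => ?_, card_filter_eq_add_sub ?_⟩
  · rw [pow_add] at hx hy
    have hdiv : ∀ z j : ℕ, z / q ^ k / q / q ^ j = z / q ^ (k + 1 + j) := fun z j => by
      rw [Nat.div_div_eq_div_mul, Nat.div_div_eq_div_mul, pow_add, pow_succ, mul_assoc]
    rw [hτ, eq_add_mul_iff_mod_div hr, forall_div_pow_mod_eq_iff,
      eq_add_pow_sub_iff_digits hn hnlt (Nat.div_lt_of_lt_mul hx) (Nat.div_lt_of_lt_mul hy)]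
    simp only [hdiv]
    refine and_congr_right' (and_congr_right' (and_congr_right' ⟨fun h j hkj hj => ?_,
      fun h j hj => h _ (by omega) (by omega)⟩))
    obtain ⟨d, rfl⟩ := Nat.exists_eq_add_of_le hkj
    exact h d (by omega)
  · rw [pow_add, mul_comm]
    exact Nat.mul_le_mul_left _ hnpow
end

section
/- Fix integers q ≥ 2, m ≥ 2, functions h_1, …, h_{m−1}, h'_1, …, h'_{m−1}, g_1, …, g_m : ℤ_q → ℤ_q and a permutation π of {1, …, m}. Define f : ℤ_q^m → ℤ_q by f(x_1,…,x_m) = ∑_{i=1}^{m−1} h_i(x_{π(i)}) h'_i(x_{π(i+1)}) + ∑_{j=1}^m g_j(x_j), and for t ∈ ℤ_q let ψ(C_t) be the code whose d-th sequence (d ∈ ℤ_q) has x-th entry ξ_q^{f(x_1,…,x_m) + d·x_{π(1)} + t·x_{π(m)}} for x ∈ {0, …, q^m−1} with base-q digits (x_1,…,x_m). Then for any t, t' ∈ ℤ_q, Θ(ψ(C_t), ψ(C_{t'}))(0) = q^{m+1} if t = t', and Θ(ψ(C_t), ψ(C_{t'}))(0) = 0 if t ≠ t'. -/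
open scoped Classical

/-- `ξ_q = exp(2πi/q)`, a primitive `q`-th root of unity. -/
noncomputable def xi (q : ℕ) : ℂ := Complex.exp (2 * Real.pi * Complex.I / q)

/-- The `(j+1)`-st base-`q` digit `x_{j+1}` of `x` (so `x = ∑_j x_{j+1} q^j`),
regarded as an element of `ℤ_q`. -/
def dig (q x j : ℕ) : ZMod q := (((x / q ^ j) % q : ℕ) : ZMod q)

/-- The function `f(x_1,…,x_m) = ∑_{i=1}^{m−1} h_i(x_{π(i)}) h'_i(x_{π(i+1)})
+ ∑_{j=1}^m g_j(x_j)` evaluated at the base-`q` digit vector of `x ∈ {0,…,q^m−1}`.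
Here indices are 0-based: `h i`, `h' i` stand for `h_{i+1}`, `h'_{i+1}`, and `π` is a
permutation of the `m` digit positions. -/
def qfun (q m : ℕ) (hm : 2 ≤ m) (h h' : Fin (m - 1) → ZMod q → ZMod q)
    (g : Fin m → ZMod q → ZMod q) (π : Equiv.Perm (Fin m)) (x : ℕ) : ZMod q :=
  (∑ i : Fin (m - 1),
      h i (dig q x (π (Fin.castLE (by omega) i))) *
        h' i (dig q x (π (Fin.cast (by omega) i.succ)))) +
    ∑ j : Fin m, g j (dig q x j)

/-- `F_{x,t} = f(x_1,…,x_m) + t·x_{π(m)}`. -/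
def Fqt (q m : ℕ) (hm : 2 ≤ m) (h h' : Fin (m - 1) → ZMod q → ZMod q)
    (g : Fin m → ZMod q → ZMod q) (π : Equiv.Perm (Fin m)) (x : ℕ) (t : ZMod q) :
    ZMod q :=
  qfun q m hm h h' g π x + t * dig q x (π ⟨m - 1, by omega⟩)

/-- The code `ψ(C_t)`: its `d`-th sequence (`d ∈ ℤ_q`) has `x`-th entry
`ξ_q^{f(x_1,…,x_m) + d·x_{π(1)} + t·x_{π(m)}}`. -/
noncomputable def psiC (q m : ℕ) (hm : 2 ≤ m) (h h' : Fin (m - 1) → ZMod q → ZMod q)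
    (g : Fin m → ZMod q → ZMod q) (π : Equiv.Perm (Fin m)) (t : ZMod q) :
    ZMod q → ℕ → ℂ :=
  fun d x =>
    xi q ^ (Fqt q m hm h h' g π x t + d * dig q x (π ⟨0, by omega⟩)).val

theorem xi_pow_val (q : ℕ) [NeZero q] (a : ZMod q) : xi q ^ a.val = ZMod.stdAddChar a := by
  rw [ZMod.stdAddChar_apply, ZMod.toCircle_apply, xi, ← Complex.exp_nat_mul]
  congr 1
  ring

theorem sum_fin_natCast_zmod (q : ℕ) [NeZero q] (φ : ZMod q → ℂ) :
    ∑ k : Fin q, φ ((k : ℕ) : ZMod q) = ∑ z, φ z := by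
  refine Fintype.sum_bijective (fun k : Fin q => ((k : ℕ) : ZMod q)) ⟨?_, ?_⟩ _ _ fun _ => rfl
  · intro a b hab
    have := congrArg ZMod.val hab
    simp only [ZMod.val_natCast, Nat.mod_eq_of_lt a.isLt, Nat.mod_eq_of_lt b.isLt] at this
    exact Fin.ext this
  · intro z
    exact ⟨⟨z.val, z.val_lt⟩, ZMod.natCast_zmod_val z⟩

/-- Each value of the digit in position `j` is taken `q ^ (m - 1)` times on `{0, …, q ^ m - 1}`. -/
theorem sum_range_dig (q m : ℕ) [NeZero q] (j : Fin m) (φ : ZMod q → ℂ) :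
    ∑ x ∈ Finset.range (q ^ m), φ (dig q x j) = (q : ℂ) ^ (m - 1) * ∑ z, φ z := by
  calc ∑ x ∈ Finset.range (q ^ m), φ (dig q x j)
      = ∑ x : Fin (q ^ m), φ (dig q x j) := Finset.sum_range _
    _ = ∑ f : Fin m → Fin q, φ ((f j : ℕ) : ZMod q) :=
        Fintype.sum_equiv finFunctionFinEquiv.symm _ _ fun x => by
          rw [finFunctionFinEquiv_symm_apply_val, dig]
    _ = ∑ p : Fin q × ({i // i ≠ j} → Fin q), φ ((p.1 : ℕ) : ZMod q) :=
        Fintype.sum_equiv (Equiv.funSplitAt j (Fin q)) _ _ fun f => by simp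
    _ = (q : ℂ) ^ (m - 1) * ∑ z, φ z := by
        rw [Fintype.sum_prod_type, ← sum_fin_natCast_zmod, Finset.mul_sum]
        simp [Fintype.card_subtype_compl]

theorem psiC_mul_conj_psiC (q m : ℕ) [NeZero q] (hm : 2 ≤ m)
    (h h' : Fin (m - 1) → ZMod q → ZMod q) (g : Fin m → ZMod q → ZMod q)
    (π : Equiv.Perm (Fin m)) (t t' d : ZMod q) (x : ℕ) :
    psiC q m hm h h' g π t d x * (starRingEnd ℂ) (psiC q m hm h h' g π t' d x) =
      ZMod.stdAddChar ((t - t') * dig q x (π ⟨m - 1, by omega⟩)) := by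
  rw [psiC, psiC, xi_pow_val, xi_pow_val, ← AddChar.map_neg_eq_conj, ← AddChar.map_add_eq_mul,
    Fqt, Fqt]
  congr 1
  ring

theorem sum_stdAddChar_mul (q : ℕ) [NeZero q] (c : ZMod q) :
    ∑ z : ZMod q, (ZMod.stdAddChar (c * z) : ℂ) = if c = 0 then (q : ℂ) else 0 := by
  simpa [mul_comm c, ZMod.card] using
    AddChar.sum_mulShift c (ZMod.isPrimitive_stdAddChar q)

/-- for the codes `ψ(C_t)` built from `f` as above,
`Θ(ψ(C_t), ψ(C_{t'}))(0) = q^{m+1}` if `t = t'` and `= 0` otherwise. -/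
theorem stmt_7 (q m : ℕ) [NeZero q] (hq : 2 ≤ q) (hm : 2 ≤ m)
    (h h' : Fin (m - 1) → ZMod q → ZMod q) (g : Fin m → ZMod q → ZMod q)
    (π : Equiv.Perm (Fin m)) (t t' : ZMod q) :
    codeACCF (q ^ m) (psiC q m hm h h' g π t) (psiC q m hm h h' g π t') 0 =
      if t = t' then (q : ℂ) ^ (m + 1) else 0 := by
  simp only [codeACCF, accf, le_refl, if_true, Int.toNat_zero, Nat.sub_zero, Nat.add_zero,
    psiC_mul_conj_psiC]
  rw [sum_range_dig q m _ fun z => ZMod.stdAddChar ((t - t') * z), sum_stdAddChar_mul]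
  obtain ⟨n, rfl⟩ : ∃ n, m = n + 1 := ⟨m - 1, by omega⟩
  split_ifs with h₁ h₂ h₂
  · simp [ZMod.card]
    ring
  · exact absurd (sub_eq_zero.mp h₁) h₂
  · exact absurd (sub_eq_zero.mpr h₂) h₁
  · simp
end
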